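/- For every integer m with m ≡ 2 (mod 4) (m = 2, 6, 10, ...): −|B_{m+2}|/2 < γ_m < (m+3)(m+4)·|B_{m+4}|/48 − |B_{m+2}|/2; and for every positive integer m with m ≡ 0 (mod 4) (m = 4, 8, 12, ...): |B_{m+2}|/2 − (m+3)(m+4)·|B_{m+4}|/48 < γ_m < |B_{m+2}|/2. -/

import Mathlib

open Finset Filter Real

/-- The defining sequence for the `m`-th generalized Euler (Stieltjes) constant:
`Σ_{k=1}^n ln^m k / k − ln^{m+1} n / (m+1)`. -/
noncomputable def stieltjesSeq (m : ℕ) (n : ℕ) : ℝ :=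
  (∑ k ∈ Finset.range n, (Real.log (k + 1)) ^ m / (k + 1)) -
    (Real.log n) ^ (m + 1) / (m + 1)

open MeasureTheory Set

/-- A probability law on `(0, ∞)` with prescribed first three moments and Laplace transform. -/
structure IsPositiveLaw (μ : Measure ℝ) (M₁ M₂ M₃ : ℝ) (F : ℝ → ℝ) : Prop where
  prob : IsProbabilityMeasure μ
  pos : ∀ᵐ s ∂μ, 0 < s
  integrable_one : Integrable (fun s => s) μ
  integrable_two : Integrable (fun s => s ^ 2) μ
  integrable_three : Integrable (fun s => s ^ 3) μ
  moment_one : ∫ s, s ∂μ = M₁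
  moment_two : ∫ s, s ^ 2 ∂μ = M₂
  moment_three : ∫ s, s ^ 3 ∂μ = M₃
  laplace : ∀ x, 0 < x → ∫ s, exp (-(x * s)) ∂μ = F x

lemma integrable_exp_neg_mul_of_pos {μ : Measure ℝ} [IsFiniteMeasure μ] (h : ∀ᵐ s ∂μ, 0 < s)
    {x : ℝ} (hx : 0 ≤ x) : Integrable (fun s => exp (-(x * s))) μ := by
  refine Integrable.of_bound (by fun_prop) 1 ?_
  filter_upwards [h] with s hs
  rw [norm_of_nonneg (exp_pos _).le, exp_le_one_iff]
  have := mul_nonneg hx hs.le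
  linarith

/-- The law of a sum of two independent positive variables. -/
lemma IsPositiveLaw.add {μ ν : Measure ℝ} {a b c a' b' c' : ℝ} {F G : ℝ → ℝ}
    (h : IsPositiveLaw μ a b c F) (h' : IsPositiveLaw ν a' b' c' G) :
    IsPositiveLaw ((μ.prod ν).map fun p => p.1 + p.2) (a + a') (b + 2 * a * a' + b')
      (c + 3 * b * a' + 3 * a * b' + c') fun x => F x * G x := by
  have := h.prob
  have := h'.prob
  have hm : Measurable fun p : ℝ × ℝ => p.1 + p.2 := by fun_prop
  have i1 : Integrable (fun p : ℝ × ℝ => p.1) (μ.prod ν) := h.integrable_one.comp_fst ν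
  have i2 : Integrable (fun p : ℝ × ℝ => p.1 ^ 2) (μ.prod ν) := h.integrable_two.comp_fst ν
  have i3 : Integrable (fun p : ℝ × ℝ => p.1 ^ 3) (μ.prod ν) := h.integrable_three.comp_fst ν
  have j1 : Integrable (fun p : ℝ × ℝ => p.2) (μ.prod ν) := h'.integrable_one.comp_snd μ
  have j2 : Integrable (fun p : ℝ × ℝ => p.2 ^ 2) (μ.prod ν) := h'.integrable_two.comp_snd μ
  have j3 : Integrable (fun p : ℝ × ℝ => p.2 ^ 3) (μ.prod ν) := h'.integrable_three.comp_snd μ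
  have k11 : Integrable (fun p : ℝ × ℝ => p.1 * p.2) (μ.prod ν) :=
    h.integrable_one.mul_prod h'.integrable_one
  have k21 : Integrable (fun p : ℝ × ℝ => p.1 ^ 2 * p.2) (μ.prod ν) :=
    h.integrable_two.mul_prod h'.integrable_one
  have k12 : Integrable (fun p : ℝ × ℝ => p.1 * p.2 ^ 2) (μ.prod ν) :=
    h.integrable_one.mul_prod h'.integrable_two
  have e2 : (fun p : ℝ × ℝ => (p.1 + p.2) ^ 2) =
      fun p => p.1 ^ 2 + 2 * (p.1 * p.2) + p.2 ^ 2 := by ext p; ring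
  have e3 : (fun p : ℝ × ℝ => (p.1 + p.2) ^ 3) =
      fun p => p.1 ^ 3 + 3 * (p.1 ^ 2 * p.2) + 3 * (p.1 * p.2 ^ 2) + p.2 ^ 3 := by ext p; ring
  have v {f : ℝ → ℝ} : ∫ p : ℝ × ℝ, f p.1 ∂(μ.prod ν) = ∫ s, f s ∂μ := by
    simpa using integral_fun_fst (μ := μ) (ν := ν) f
  have w {f : ℝ → ℝ} : ∫ p : ℝ × ℝ, f p.2 ∂(μ.prod ν) = ∫ s, f s ∂ν := by
    simpa using integral_fun_snd (μ := μ) (ν := ν) f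
  refine ⟨Measure.isProbabilityMeasure_map hm.aemeasurable, ?_, ?_, ?_, ?_, ?_, ?_, ?_, ?_⟩
  · rw [ae_map_iff hm.aemeasurable measurableSet_Ioi]
    filter_upwards [Measure.quasiMeasurePreserving_fst.ae h.pos,
      Measure.quasiMeasurePreserving_snd.ae h'.pos] with p hp hq
    exact add_pos hp hq
  · rw [integrable_map_measure (by fun_prop) hm.aemeasurable]
    exact i1.add j1
  · rw [integrable_map_measure (by fun_prop) hm.aemeasurable]
    change Integrable (fun p : ℝ × ℝ => (p.1 + p.2) ^ 2) _
    rw [e2]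
    fun_prop
  · rw [integrable_map_measure (by fun_prop) hm.aemeasurable]
    change Integrable (fun p : ℝ × ℝ => (p.1 + p.2) ^ 3) _
    rw [e3]
    fun_prop
  · rw [integral_map hm.aemeasurable (by fun_prop), integral_add i1 j1, v (f := fun s => s),
      w (f := fun s => s), h.moment_one, h'.moment_one]
  · rw [integral_map hm.aemeasurable (by fun_prop), e2, integral_add (by fun_prop) (by fun_prop),
      integral_add (by fun_prop) (by fun_prop), integral_const_mul,
      integral_prod_mul (fun s => s) (fun s => s), v (f := fun s => s ^ 2),
      w (f := fun s => s ^ 2), h.moment_one, h'.moment_one, h.moment_two, h'.moment_two]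
    ring
  · rw [integral_map hm.aemeasurable (by fun_prop), e3, integral_add (by fun_prop) (by fun_prop),
      integral_add (by fun_prop) (by fun_prop), integral_add (by fun_prop) (by fun_prop),
      integral_const_mul, integral_const_mul,
      integral_prod_mul (fun s => s ^ 2) (fun s => s),
      integral_prod_mul (fun s => s) (fun s => s ^ 2), v (f := fun s => s ^ 3),
      w (f := fun s => s ^ 3), h.moment_one, h'.moment_one, h.moment_two, h'.moment_two,
      h.moment_three, h'.moment_three]
    ring
  · intro x hx
    rw [integral_map hm.aemeasurable (by fun_prop)]
    simp_rw [mul_add, neg_add, exp_add]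
    rw [integral_prod_mul (fun s => exp (-(x * s))) (fun s => exp (-(x * s))),
      h.laplace x hx, h'.laplace x hx]

/-- The standard exponential law. -/
lemma exists_isPositiveLaw_inv :
    ∃ μ : Measure ℝ, IsPositiveLaw μ 1 2 6 fun x => 1 / (1 + x) := by
  have hm : Measurable fun s : ℝ => ENNReal.ofReal (exp (-s)) := by fun_prop
  let μ : Measure ℝ := (volume.restrict (Ioi 0)).withDensity fun s => ENNReal.ofReal (exp (-s))
  have hint (f : ℝ → ℝ) : ∫ s, f s ∂μ = ∫ s in Ioi 0, exp (-s) * f s := by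
    rw [integral_withDensity_eq_integral_toReal_smul hm (by simp)]
    simp [(exp_pos _).le]
  have hmom (k : ℕ) : IntegrableOn (fun s : ℝ => exp (-s) * s ^ k) (Ioi 0) ∧
      ∫ s in Ioi (0 : ℝ), exp (-s) * s ^ k = k.factorial := by
    have h1 := Real.GammaIntegral_convergent (s := k + 1) (by positivity)
    have h2 := Real.Gamma_eq_integral (s := k + 1) (by positivity)
    rw [Real.Gamma_nat_eq_factorial] at h2
    simp only [add_sub_cancel_right, rpow_natCast] at h1 h2
    exact ⟨h1, h2.symm⟩
  have hi (k : ℕ) : Integrable (fun s : ℝ => s ^ k) μ := by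
    rw [integrable_withDensity_iff hm (by simp)]
    have := (hmom k).1
    simp only [ENNReal.toReal_ofReal (exp_pos _).le]
    exact this.congr (by filter_upwards with s; ring)
  have hlap (x : ℝ) (hx : 0 ≤ x) : ∫ s in Ioi (0 : ℝ), exp (-s) * exp (-(x * s)) = 1 / (1 + x) := by
    have := integral_exp_mul_Ioi (a := -(1 + x)) (by linarith) 0
    simp only [mul_zero, exp_zero] at this
    rw [show 1 / (1 + x) = -1 / -(1 + x) by rw [neg_div_neg_eq], ← this]
    congr 1 with s
    rw [← exp_add]; ring_nf
  refine ⟨μ, ⟨?_⟩, ?_, by simpa using hi 1, hi 2, hi 3, ?_, ?_, ?_, ?_⟩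
  · have h0 := (hmom 0).2
    rw [withDensity_apply _ MeasurableSet.univ, Measure.restrict_univ,
      ← ofReal_integral_eq_lintegral_ofReal (by simpa [IntegrableOn] using (hmom 0).1)
        (by filter_upwards with s using (exp_pos _).le)]
    simp only [pow_zero, mul_one, Nat.factorial_zero, Nat.cast_one] at h0
    rw [h0, ENNReal.ofReal_one]
  · exact (withDensity_absolutelyContinuous _ _).ae_le (ae_restrict_mem measurableSet_Ioi)
  · simpa [hint] using (hmom 1).2
  · simpa [hint] using (hmom 2).2
  · rw [hint, (hmom 3).2]; norm_num [Nat.factorial]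
  · intro x hx
    rw [hint, hlap x hx.le]

/-- The law of `U * T` with `U` uniform on `(0, 1)` and `T` standard exponential. -/
lemma exists_isPositiveLaw_log :
    ∃ μ : Measure ℝ, IsPositiveLaw μ (1 / 2) (2 / 3) (3 / 2) fun x => log (1 + x) / x := by
  obtain ⟨ν, h⟩ := exists_isPositiveLaw_inv
  have := h.prob
  let u : Measure ℝ := volume.restrict (Ioc 0 1)
  have hu : IsProbabilityMeasure u := ⟨by simp [u]⟩
  have hpos : ∀ᵐ s ∂u, 0 < s := by
    filter_upwards [ae_restrict_mem measurableSet_Ioc] with s hs using hs.1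
  have hi (k : ℕ) : Integrable (fun s => s ^ k) u := by
    have : IntervalIntegrable (fun s : ℝ => s ^ k) volume 0 1 :=
      (by fun_prop : Continuous fun s : ℝ => s ^ k).intervalIntegrable _ _
    exact this.1
  have hv (k : ℕ) : ∫ s, s ^ k ∂u = 1 / (k + 1) := by
    rw [← intervalIntegral.integral_of_le zero_le_one, integral_pow]; simp
  have hi1 : Integrable (fun s => s) u := by simpa using hi 1
  have hv1 : ∫ s, s ∂u = 1 / 2 := by
    have := hv 1
    norm_num at this ⊢
    exact this
  have hm : Measurable fun p : ℝ × ℝ => p.1 * p.2 := by fun_prop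
  have hP : ∀ᵐ p ∂u.prod ν, 0 < p.1 ∧ 0 < p.2 := by
    filter_upwards [Measure.quasiMeasurePreserving_fst.ae hpos,
      Measure.quasiMeasurePreserving_snd.ae h.pos] with p hp hq using ⟨hp, hq⟩
  refine ⟨(u.prod ν).map fun p => p.1 * p.2,
    Measure.isProbabilityMeasure_map hm.aemeasurable, ?_, ?_, ?_, ?_, ?_, ?_, ?_, ?_⟩
  · rw [ae_map_iff hm.aemeasurable measurableSet_Ioi]
    filter_upwards [hP] with p hp using mul_pos hp.1 hp.2
  · rw [integrable_map_measure (by fun_prop) hm.aemeasurable]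
    exact hi1.mul_prod h.integrable_one
  · rw [integrable_map_measure (by fun_prop) hm.aemeasurable]
    simpa only [Function.comp_def, mul_pow] using (hi 2).mul_prod h.integrable_two
  · rw [integrable_map_measure (by fun_prop) hm.aemeasurable]
    simpa only [Function.comp_def, mul_pow] using (hi 3).mul_prod h.integrable_three
  · rw [integral_map hm.aemeasurable (by fun_prop),
      integral_prod_mul (fun s => s) (fun s => s), hv1, h.moment_one]
    norm_num
  · rw [integral_map hm.aemeasurable (by fun_prop)]
    simp_rw [mul_pow]
    rw [integral_prod_mul (fun s => s ^ 2) (fun s => s ^ 2), hv, h.moment_two]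
    norm_num
  · rw [integral_map hm.aemeasurable (by fun_prop)]
    simp_rw [mul_pow]
    rw [integral_prod_mul (fun s => s ^ 3) (fun s => s ^ 3), hv, h.moment_three]
    norm_num
  · intro x hx
    rw [integral_map hm.aemeasurable (by fun_prop), integral_prod]
    · have : ∀ᵐ s ∂u, ∫ t, exp (-(x * (s * t))) ∂ν = 1 / (1 + x * s) := by
        filter_upwards [hpos] with s hs
        rw [← h.laplace _ (mul_pos hx hs)]
        simp_rw [mul_assoc]
      rw [integral_congr_ae this, ← intervalIntegral.integral_of_le zero_le_one,
        intervalIntegral.integral_comp_add_mul (fun y => 1 / y) hx.ne', integral_one_div]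
      · simp [div_eq_inv_mul]
      · rw [Set.uIcc_of_le (by linarith)]
        intro hh
        have := hh.1
        linarith
    · refine Integrable.of_bound (by fun_prop) 1 ?_
      filter_upwards [hP] with p hp
      rw [norm_of_nonneg (exp_pos _).le, exp_le_one_iff]
      have := mul_pos hx (mul_pos hp.1 hp.2)
      linarith

/-- The function `log (1 + x) ^ m / (x ^ m * (1 + x))` is the Laplace transform of a law. -/
lemma exists_isPositiveLaw_log_pow (m : ℕ) :
    ∃ μ : Measure ℝ, IsPositiveLaw μ ((m + 2) / 2) ((3 * m + 8) * (m + 3) / 12)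
      ((m + 3) * (m + 4) ^ 2 / 8) fun x => (log (1 + x) / x) ^ m / (1 + x) := by
  induction m with
  | zero =>
    obtain ⟨μ, h⟩ := exists_isPositiveLaw_inv
    refine ⟨μ, ?_⟩
    convert h using 1 <;> norm_num
  | succ m ih =>
    obtain ⟨μ, h⟩ := ih
    obtain ⟨ν, h'⟩ := exists_isPositiveLaw_log
    refine ⟨(μ.prod ν).map fun p => p.1 + p.2, ?_⟩
    convert h.add h' using 1
    · push_cast; ring
    · push_cast; ring
    · push_cast; ring
    · ext x; ring

lemma pow_inv_one_add_eq_one_sub (c : ℂ) (hc : 1 + c ≠ 0) (n : ℕ) :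
    ((1 + c)⁻¹) ^ n = 1 - c * ∑ k ∈ range n, ((1 + c)⁻¹) ^ (k + 1) := by
  induction n with
  | zero => simp
  | succ n ih =>
    rw [sum_range_succ, mul_add, ← sub_sub, ← ih, pow_succ]
    field_simp
    ring

lemma one_add_mul_I_ne_zero (u : ℝ) : 1 + (u : ℂ) * Complex.I ≠ 0 := fun h => by
  simpa using congrArg Complex.re h

lemma im_pow_inv_one_add_mul_I (u : ℝ) (n : ℕ) :
    (((1 + (u : ℂ) * Complex.I)⁻¹) ^ n).im =
      -(u * ∑ k ∈ range n, (((1 + (u : ℂ) * Complex.I)⁻¹) ^ (k + 1)).re) := by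
  conv_lhs => rw [pow_inv_one_add_eq_one_sub _ (one_add_mul_I_ne_zero u), mul_assoc]
  rw [Complex.sub_im, Complex.im_ofReal_mul, Complex.I_mul_im, Complex.re_sum]
  simp

lemma re_pow_inv_one_add_mul_I (u : ℝ) (n : ℕ) :
    (((1 + (u : ℂ) * Complex.I)⁻¹) ^ n).re =
      1 + u * ∑ k ∈ range n, (((1 + (u : ℂ) * Complex.I)⁻¹) ^ (k + 1)).im := by
  conv_lhs => rw [pow_inv_one_add_eq_one_sub _ (one_add_mul_I_ne_zero u), mul_assoc]
  rw [Complex.sub_re, Complex.re_ofReal_mul, Complex.I_mul_re, Complex.im_sum]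
  simp

lemma re_pow_inv_one_add_mul_I_lt_one {u : ℝ} (hu : 0 < u) (k : ℕ) :
    (((1 + (u : ℂ) * Complex.I)⁻¹) ^ (k + 1)).re < 1 := by
  refine (Complex.re_le_norm _).trans_lt ?_
  rw [norm_pow, norm_inv]
  refine pow_lt_one₀ (by positivity) (inv_lt_one_of_one_lt₀ ?_) (by simp)
  have := Complex.norm_add_mul_I 1 u
  rw [Complex.ofReal_one] at this
  rw [this, Real.lt_sqrt (by norm_num)]
  nlinarith

lemma neg_im_pow_inv_one_add_mul_I_lt {u : ℝ} (hu : 0 < u) (n : ℕ) :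
    -(((1 + (u : ℂ) * Complex.I)⁻¹) ^ (n + 1)).im < (n + 1) * u := by
  rw [im_pow_inv_one_add_mul_I, neg_neg, mul_comm _ u]
  refine mul_lt_mul_of_pos_left ?_ hu
  calc _ < ∑ k ∈ range (n + 1), (1 : ℝ) :=
        sum_lt_sum_of_nonempty (by simp) fun k _ => re_pow_inv_one_add_mul_I_lt_one hu k
    _ = n + 1 := by simp

lemma lt_re_pow_inv_one_add_mul_I {u : ℝ} (hu : 0 < u) (n : ℕ) :
    1 - u ^ 2 * ((n + 1) * (n + 2) / 2) < (((1 + (u : ℂ) * Complex.I)⁻¹) ^ (n + 1)).re := by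
  rw [re_pow_inv_one_add_mul_I]
  have h1 : ∑ k ∈ range (n + 1), -(((1 + (u : ℂ) * Complex.I)⁻¹) ^ (k + 1)).im
      < ∑ k ∈ range (n + 1), ((k : ℝ) + 1) * u :=
    sum_lt_sum_of_nonempty (by simp) fun k _ => neg_im_pow_inv_one_add_mul_I_lt hu k
  have h2 : ∀ n : ℕ, ∑ k ∈ range (n + 1), ((k : ℝ) + 1) * u = (n + 1) * (n + 2) / 2 * u := by
    intro n
    induction n with
    | zero => simp
    | succ n ih => rw [sum_range_succ, ih]; push_cast; ring
  rw [h2, sum_neg_distrib] at h1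
  nlinarith

lemma lt_neg_im_pow_inv_one_add_mul_I {u : ℝ} (hu : 0 < u) (n : ℕ) :
    (n + 1) * u - (n + 1) * (n + 2) * (n + 3) / 6 * u ^ 3
      < -(((1 + (u : ℂ) * Complex.I)⁻¹) ^ (n + 1)).im := by
  rw [im_pow_inv_one_add_mul_I, neg_neg]
  have h1 : ∑ k ∈ range (n + 1), (1 - u ^ 2 * (((k : ℝ) + 1) * (k + 2) / 2))
      < ∑ k ∈ range (n + 1), (((1 + (u : ℂ) * Complex.I)⁻¹) ^ (k + 1)).re :=
    sum_lt_sum_of_nonempty (by simp) fun k _ => lt_re_pow_inv_one_add_mul_I hu k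
  have h2 : ∀ n : ℕ, ∑ k ∈ range (n + 1), (1 - u ^ 2 * (((k : ℝ) + 1) * (k + 2) / 2)) =
      (n + 1) - (n + 1) * (n + 2) * (n + 3) / 6 * u ^ 2 := by
    intro n
    induction n with
    | zero => norm_num
    | succ n ih => rw [sum_range_succ, ih]; push_cast; ring
  rw [h2] at h1
  have := mul_lt_mul_of_pos_left h1 hu
  linarith

lemma hasSum_zeta_abs_bernoulli {k : ℕ} (hk : k ≠ 0) :
    HasSum (fun n : ℕ => 1 / ((n : ℝ) + 1) ^ (2 * k))
      ((2 * π) ^ (2 * k) * |((bernoulli (2 * k) : ℚ) : ℝ)| / (2 * (2 * k).factorial)) := by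
  have h := hasSum_zeta_nat hk
  have h0 := h.nonneg fun n => by positivity
  rw [← abs_of_nonneg h0, abs_div, abs_mul, abs_mul, abs_mul, abs_pow, abs_neg, abs_one, one_pow,
    one_mul, abs_of_nonneg (by positivity : (0 : ℝ) ≤ 2 ^ (2 * k - 1)),
    abs_of_nonneg (by positivity : (0 : ℝ) ≤ π ^ (2 * k)), Nat.abs_cast] at h
  have h' := (hasSum_nat_add_iff' 1).2 h
  simp only [sum_range_one, Nat.cast_zero, Nat.cast_add, Nat.cast_one] at h'
  rw [zero_pow (by omega), div_zero, sub_zero] at h'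
  convert! h' using 1
  obtain ⟨j, rfl⟩ : ∃ j, k = j + 1 := ⟨k - 1, by omega⟩
  rw [show 2 * (j + 1) - 1 = 2 * j + 1 by omega]
  field_simp
  ring

lemma mul_I_pow_odd (x : ℂ) (q : ℕ) :
    (x * Complex.I) ^ (2 * q + 1) = x ^ (2 * q + 1) * ((-1) ^ q * Complex.I) := by
  rw [mul_pow, pow_succ Complex.I, pow_mul Complex.I, Complex.I_sq]

lemma inv_pow_odd_add_inv_pow_odd (q n : ℕ) (u : ℝ) :
    1 / (((n + 1 : ℝ) : ℂ) * (1 + u * Complex.I)) ^ (2 * q + 1) +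
      1 / (-(((n + 1 : ℝ) : ℂ) * (1 - u * Complex.I))) ^ (2 * q + 1) =
    2 * (((1 + (u : ℂ) * Complex.I)⁻¹ ^ (2 * q + 1)).im / ((n + 1 : ℝ) ^ (2 * q + 1) : ℝ) : ℝ) *
      Complex.I := by
  have hc : ((1 - (u : ℂ) * Complex.I)⁻¹) ^ (2 * q + 1) =
      (starRingEnd ℂ) ((1 + (u : ℂ) * Complex.I)⁻¹ ^ (2 * q + 1)) := by
    simp [sub_eq_add_neg]
  have h := Complex.sub_conj ((1 + (u : ℂ) * Complex.I)⁻¹ ^ (2 * q + 1))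
  rw [(odd_two_mul_add_one q).neg_pow, mul_pow, mul_pow, one_div, one_div, inv_neg, mul_inv,
    mul_inv, ← inv_pow (1 + (u : ℂ) * Complex.I), ← inv_pow (1 - (u : ℂ) * Complex.I), hc,
    ← sub_eq_add_neg, ← mul_sub, h]
  push_cast
  ring

/-- Lipschitz summation for `∑ j ^ m * exp (-s * j)` with `m` even. -/
lemma hasSum_im_pow_inv {q : ℕ} (hq : q ≠ 0) {s : ℝ} (hs : 0 < s) :
    HasSum (fun n : ℕ => 2 * (2 * q).factorial / (2 * π) ^ (2 * q + 1) *
      (-(((1 + ((s / (2 * π * (n + 1)) : ℝ) : ℂ) * Complex.I)⁻¹) ^ (2 * q + 1)).im /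
        ((n : ℝ) + 1) ^ (2 * q + 1)))
      ((-1) ^ q * (∑' j : ℕ, (j : ℝ) ^ (2 * q) * exp (-(j * s)) -
        (2 * q).factorial / s ^ (2 * q + 1))) := by
  have hπ := Real.pi_pos
  have hπ' : (π : ℂ) ≠ 0 := by exact_mod_cast hπ.ne'
  have hs' : (s : ℂ) ≠ 0 := by exact_mod_cast hs.ne'
  have hI := Complex.I_ne_zero
  set w : ℂ := ((s / (2 * π) : ℝ) : ℂ) * Complex.I with hw
  have hw0 : 0 < w.im := by
    rw [hw, Complex.im_ofReal_mul, Complex.I_im, mul_one]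
    positivity
  have hL := EisensteinSeries.qExpansion_identity (k := 2 * q) (by omega) ⟨w, hw0⟩
  change ∑' n : ℤ, 1 / (w + n) ^ (2 * q + 1) = _ * ∑' n : ℕ, n ^ (2 * q) *
    Complex.exp (2 * π * Complex.I * w) ^ n at hL
  have hsum : Summable fun n : ℤ => 1 / (w + n) ^ (2 * q + 1) := by
    have := EisensteinSeries.linear_right_summable w 1 (k := 2 * q + 1) (by omega)
    refine this.congr fun n => ?_
    rw [one_div]
    norm_cast
    simp
  have hexp : ∑' n : ℕ, (n : ℂ) ^ (2 * q) * Complex.exp (2 * π * Complex.I * w) ^ n =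
      ((∑' j : ℕ, (j : ℝ) ^ (2 * q) * exp (-(j * s)) : ℝ) : ℂ) := by
    rw [Complex.ofReal_tsum]
    congr 1 with n
    rw [← Complex.exp_nat_mul]
    push_cast
    congr 2
    rw [hw]
    push_cast
    field_simp
    simp
  have h := (hasSum_nat_add_iff' 1).2 hsum.hasSum.nat_add_neg
  rw [hL, hexp] at h
  replace h := h.mul_left ((2 * q).factorial * Complex.I / (2 * π) ^ (2 * q + 1))
  rw [← Complex.hasSum_ofReal]
  convert! h using 1
  · ext n
    have e1 : w + ((n + 1 : ℕ) : ℤ) =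
        ((n + 1 : ℝ) : ℂ) * (1 + ((s / (2 * π * (n + 1)) : ℝ) : ℂ) * Complex.I) := by
      rw [hw]
      have : (n : ℂ) + 1 ≠ 0 := by exact_mod_cast n.succ_ne_zero
      push_cast
      field_simp
      ring
    have e2 : w + ((-((n + 1 : ℕ) : ℤ) : ℤ) : ℂ) =
        -(((n + 1 : ℝ) : ℂ) * (1 - ((s / (2 * π * (n + 1)) : ℝ) : ℂ) * Complex.I)) := by
      rw [hw]
      have : (n : ℂ) + 1 ≠ 0 := by exact_mod_cast n.succ_ne_zero
      push_cast
      field_simp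
      ring
    rw [e1, e2, inv_pow_odd_add_inv_pow_odd]
    generalize ((1 + ((s / (2 * π * (n + 1)) : ℝ) : ℂ) * Complex.I)⁻¹ ^ (2 * q + 1)).im = y
    push_cast
    linear_combination -(2 * ((2 * q).factorial : ℂ) / (2 * π) ^ (2 * q + 1) *
      (y / (n + 1) ^ (2 * q + 1))) * Complex.I_sq
  · simp only [Finset.range_one, sum_singleton, Nat.cast_zero, Int.cast_zero, neg_zero, add_zero]
    rw [hw, mul_I_pow_odd (-2 * π), mul_I_pow_odd, neg_mul, (odd_two_mul_add_one q).neg_pow]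
    generalize ∑' j : ℕ, (j : ℝ) ^ (2 * q) * exp (-(j * s)) = T
    push_cast
    rw [div_pow]
    have : ((2 * q).factorial : ℂ) ≠ 0 := by exact_mod_cast (2 * q).factorial_ne_zero
    obtain h1 | h1 := neg_one_pow_eq_or ℂ q <;> rw [h1] <;> field_simp <;> simp <;> ring

/-- The defect `∑ j ^ m * exp (-s * j) - ∫ x ^ m * exp (-s * x)`, `m = 2 * q`, is enveloped by its
Taylor polynomials at `0`. -/
lemma tsum_pow_mul_exp_sub_bounds {q : ℕ} (hq : q ≠ 0) {s : ℝ} (hs : 0 < s) :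
    |((bernoulli (2 * q + 2) : ℚ) : ℝ)| / (2 * q + 2) * s -
        |((bernoulli (2 * q + 4) : ℚ) : ℝ)| / (6 * (2 * q + 4)) * s ^ 3 <
      (-1) ^ q * (∑' j : ℕ, (j : ℝ) ^ (2 * q) * exp (-(j * s)) -
        (2 * q).factorial / s ^ (2 * q + 1)) ∧
    (-1) ^ q * (∑' j : ℕ, (j : ℝ) ^ (2 * q) * exp (-(j * s)) -
        (2 * q).factorial / s ^ (2 * q + 1)) <
      |((bernoulli (2 * q + 2) : ℚ) : ℝ)| / (2 * q + 2) * s := by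
  have hπ := Real.pi_pos
  have h := hasSum_im_pow_inv hq hs
  have hz1 := (hasSum_zeta_abs_bernoulli (k := q + 1) (by omega)).mul_left
    (2 * (2 * q).factorial / (2 * π) ^ (2 * q + 1) * ((2 * q + 1) * (s / (2 * π))))
  have hz2 := (hasSum_zeta_abs_bernoulli (k := q + 2) (by omega)).mul_left
    (2 * (2 * q).factorial / (2 * π) ^ (2 * q + 1) *
      ((2 * q + 1) * (2 * q + 2) * (2 * q + 3) / 6 * (s / (2 * π)) ^ 3))
  rw [show 2 * (q + 1) = 2 * q + 2 by ring] at hz1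
  rw [show 2 * (q + 2) = 2 * q + 4 by ring] at hz2
  have v1 : 2 * (2 * q).factorial / (2 * π) ^ (2 * q + 1) * ((2 * q + 1) * (s / (2 * π))) *
      ((2 * π) ^ (2 * q + 2) * |((bernoulli (2 * q + 2) : ℚ) : ℝ)| /
        (2 * (2 * q + 2).factorial)) = |((bernoulli (2 * q + 2) : ℚ) : ℝ)| / (2 * q + 2) * s := by
    simp only [Nat.factorial_succ]
    push_cast
    field_simp
    ring
  have v2 : 2 * (2 * q).factorial / (2 * π) ^ (2 * q + 1) *
      ((2 * q + 1) * (2 * q + 2) * (2 * q + 3) / 6 * (s / (2 * π)) ^ 3) *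
      ((2 * π) ^ (2 * q + 4) * |((bernoulli (2 * q + 4) : ℚ) : ℝ)| /
        (2 * (2 * q + 4).factorial)) =
      |((bernoulli (2 * q + 4) : ℚ) : ℝ)| / (6 * (2 * q + 4)) * s ^ 3 := by
    simp only [Nat.factorial_succ]
    push_cast
    field_simp
    ring
  rw [v1] at hz1
  rw [v2] at hz2
  have hK : (0 : ℝ) < 2 * (2 * q).factorial / (2 * π) ^ (2 * q + 1) := by positivity
  have hu (n : ℕ) : 0 < s / (2 * π * (n + 1)) := by positivity
  have lo (n : ℕ) := (mul_lt_mul_of_pos_left (div_lt_div_of_pos_right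
    (lt_neg_im_pow_inv_one_add_mul_I (hu n) (2 * q))
    (by positivity : (0 : ℝ) < (n + 1) ^ (2 * q + 1))) hK)
  have hi (n : ℕ) := (mul_lt_mul_of_pos_left (div_lt_div_of_pos_right
    (neg_im_pow_inv_one_add_mul_I_lt (hu n) (2 * q))
    (by positivity : (0 : ℝ) < (n + 1) ^ (2 * q + 1))) hK)
  have t1 (n : ℕ) : 2 * (2 * q).factorial / (2 * π) ^ (2 * q + 1) *
      (((2 * q : ℕ) + 1) * (s / (2 * π * (n + 1))) / ((n : ℝ) + 1) ^ (2 * q + 1)) =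
      2 * (2 * q).factorial / (2 * π) ^ (2 * q + 1) * ((2 * q + 1) * (s / (2 * π))) *
      (1 / ((n : ℝ) + 1) ^ (2 * q + 2)) := by
    push_cast
    field_simp
    ring
  have t2 (n : ℕ) : 2 * (2 * q).factorial / (2 * π) ^ (2 * q + 1) *
      ((((2 * q : ℕ) + 1) * (s / (2 * π * (n + 1))) - ((2 * q : ℕ) + 1) * ((2 * q : ℕ) + 2) *
        ((2 * q : ℕ) + 3) / 6 * (s / (2 * π * (n + 1))) ^ 3) / ((n : ℝ) + 1) ^ (2 * q + 1)) =
      2 * (2 * q).factorial / (2 * π) ^ (2 * q + 1) * ((2 * q + 1) * (s / (2 * π))) *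
      (1 / ((n : ℝ) + 1) ^ (2 * q + 2)) - 2 * (2 * q).factorial / (2 * π) ^ (2 * q + 1) *
      ((2 * q + 1) * (2 * q + 2) * (2 * q + 3) / 6 * (s / (2 * π)) ^ 3) *
      (1 / ((n : ℝ) + 1) ^ (2 * q + 4)) := by
    push_cast
    field_simp
    ring
  simp only [t1] at hi
  simp only [t2] at lo
  exact ⟨hasSum_lt (fun n => (lo n).le) (lo 0) (hz1.sub hz2) h,
    hasSum_lt (fun n => (hi n).le) (hi 0) h hz1⟩


/-- The `j`-th error of the right endpoint rule for `x ^ m * exp (-(x * s))` with unit step. -/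
noncomputable def stepError (m j : ℕ) (s : ℝ) : ℝ :=
  ((j : ℝ) + 1) ^ m * exp (-((j + 1) * s)) - ∫ x in (j : ℝ)..j + 1, x ^ m * exp (-(x * s))

lemma integral_pow_mul_exp_neg_mul (m : ℕ) {s : ℝ} (hs : 0 < s) :
    IntegrableOn (fun x : ℝ => x ^ m * exp (-(x * s))) (Ioi 0) ∧
    ∫ x in Ioi (0 : ℝ), x ^ m * exp (-(x * s)) = m.factorial / s ^ (m + 1) := by
  have h := Real.integral_rpow_mul_exp_neg_mul_Ioi (a := m + 1) (by positivity) hs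
  rw [Real.Gamma_nat_eq_factorial] at h
  simp only [add_sub_cancel_right, rpow_natCast, mul_comm s] at h
  have h' : ∫ x in Ioi (0 : ℝ), x ^ m * exp (-(x * s)) = m.factorial / s ^ (m + 1) := by
    rw [h, ← Nat.cast_add_one, rpow_natCast, one_div, inv_pow]
    field_simp
  refine ⟨?_, h'⟩
  by_contra hn
  rw [integral_undef hn] at h'
  have : (0 : ℝ) < m.factorial / s ^ (m + 1) := by positivity
  exact this.ne h'

lemma hasSum_stepError {m : ℕ} (hm : m ≠ 0) {s : ℝ} (hs : 0 < s) :
    HasSum (fun j => stepError m j s)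
      (∑' j : ℕ, (j : ℝ) ^ m * exp (-(j * s)) - m.factorial / s ^ (m + 1)) := by
  have hc : Continuous fun x : ℝ => x ^ m * exp (-(x * s)) := by fun_prop
  refine HasSum.sub ?_ ?_
  · have h1 : Summable fun j : ℕ => (j : ℝ) ^ m * exp (-(j * s)) := by
      have := Real.summable_pow_mul_exp_neg_nat_mul m hs
      refine this.congr fun n => ?_
      rw [neg_mul, mul_comm s]
    have h2 := (hasSum_nat_add_iff' 1).2 h1.hasSum
    simpa [hm] using h2
  · obtain ⟨h1, h2⟩ := integral_pow_mul_exp_neg_mul m hs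
    rw [hasSum_iff_tendsto_nat_of_nonneg]
    · have h3 := intervalIntegral_tendsto_integral_Ioi 0 h1 tendsto_natCast_atTop_atTop
      rw [h2] at h3
      refine h3.congr fun n => ?_
      have := intervalIntegral.sum_integral_adjacent_intervals (μ := volume)
        (a := fun k : ℕ => (k : ℝ)) (n := n) fun k _ => hc.intervalIntegrable k ((k + 1 : ℕ) : ℝ)
      push_cast at this
      exact this.symm
    · intro j
      refine intervalIntegral.integral_nonneg (by simp) fun x hx => ?_
      have : 0 ≤ x := (Nat.cast_nonneg j).trans hx.1
      positivity

lemma abs_stepError_le {m j : ℕ} (hm : m ≠ 0) (hj : 1 ≤ j) {s : ℝ} (hs : 0 < s) :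
    |stepError m j s| ≤ (m + 2) * (2 * j) ^ (m - 1) * exp (-(j / 2 * s)) := by
  have hj' : (1 : ℝ) ≤ j := by exact_mod_cast hj
  have hc : Continuous fun x : ℝ => x ^ m * exp (-(x * s)) := by fun_prop
  have hrw : stepError m j s = ∫ x in (j : ℝ)..j + 1,
      (((j : ℝ) + 1) ^ m * exp (-((j + 1) * s)) - x ^ m * exp (-(x * s))) := by
    rw [intervalIntegral.integral_sub (by simp) (hc.intervalIntegrable _ _)]
    simp [stepError]
  set C : ℝ := (m + 2) * (2 * j) ^ (m - 1) * exp (-(j / 2 * s)) with hC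
  have hC0 : 0 ≤ C := by positivity
  have hder (x : ℝ) : HasDerivAt (fun x : ℝ => x ^ m * exp (-(x * s)))
      (m * x ^ (m - 1) * exp (-(x * s)) + x ^ m * (exp (-(x * s)) * -s)) x := by
    have h1 : HasDerivAt (fun x : ℝ => -(x * s)) (-s) x := by
      simpa using ((hasDerivAt_id' x).mul_const s).fun_neg
    exact (hasDerivAt_pow m x).mul h1.exp
  have hbd (x : ℝ) (hx : x ∈ Icc (j : ℝ) (j + 1)) :
      ‖m * x ^ (m - 1) * exp (-(x * s)) + x ^ m * (exp (-(x * s)) * -s)‖ ≤ C := by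
    have hx0 : 0 < x := by linarith [hx.1]
    have hE : exp (-(x * s)) = exp (-(x * s / 2)) * exp (-(x * s / 2)) := by
      rw [← exp_add]; ring_nf
    have hE1 : exp (-(x * s / 2)) ≤ 1 := exp_le_one_iff.2 (by have := mul_pos hx0 hs; linarith)
    have hE2 : exp (-(x * s / 2)) ≤ exp (-(j / 2 * s)) := exp_le_exp.2 (by nlinarith [hx.1])
    have hE3 : x * s * exp (-(x * s / 2)) ≤ 2 := by
      have := add_one_le_exp (x * s / 2)
      rw [exp_neg, ← div_eq_mul_inv, div_le_iff₀ (exp_pos _)]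
      linarith
    have hp : x ^ (m - 1) ≤ (2 * j) ^ (m - 1) := by
      gcongr
      linarith [hx.2]
    have hxm : x ^ m = x ^ (m - 1) * x := by rw [← pow_succ]; congr 1; omega
    have hpos := exp_pos (-(x * s / 2))
    calc _ ≤ ‖m * x ^ (m - 1) * exp (-(x * s))‖ + ‖x ^ m * (exp (-(x * s)) * -s)‖ :=
          norm_add_le _ _
      _ = x ^ (m - 1) * exp (-(x * s / 2)) *
          (m * exp (-(x * s / 2)) + x * s * exp (-(x * s / 2))) := by
        rw [norm_of_nonneg (by positivity), mul_neg, mul_neg, norm_neg,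
          norm_of_nonneg (by positivity), hxm, hE]
        ring
      _ ≤ (2 * j) ^ (m - 1) * exp (-(j / 2 * s)) * (m * 1 + 2) := by gcongr
      _ = C := by rw [hC]; ring
  rw [hrw, ← norm_eq_abs]
  refine (intervalIntegral.norm_integral_le_of_norm_le_const (C := C) fun x hx => ?_).trans
    (by simp)
  rw [Set.uIoc_of_le (by simp)] at hx
  have := (convex_Icc (j : ℝ) (j + 1)).norm_image_sub_le_of_norm_hasDerivWithin_le
    (fun x _ => (hder x).hasDerivWithinAt) hbd (Ioc_subset_Icc_self hx)
    (right_mem_Icc.2 (by simp : (j : ℝ) ≤ j + 1))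
  refine this.trans (mul_le_of_le_one_right hC0 ?_)
  rw [norm_eq_abs, abs_le]
  constructor <;> linarith [hx.1, hx.2]

lemma integral_log_pow_div (m j : ℕ) :
    ∫ x in (j : ℝ)..j + 1, log (1 + x) ^ m / (1 + x) =
      log (j + 2) ^ (m + 1) / (m + 1) - log (j + 1) ^ (m + 1) / (m + 1) := by
  have hj : (0 : ℝ) ≤ j := j.cast_nonneg
  have hx {x : ℝ} (hx : x ∈ Set.uIcc (j : ℝ) (j + 1)) : 1 + x ≠ 0 := by
    rw [Set.uIcc_of_le (by simp)] at hx
    linarith [hx.1]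
  have hm : (m : ℝ) + 1 ≠ 0 := by positivity
  have hd (x : ℝ) (h : x ∈ Set.uIcc (j : ℝ) (j + 1)) :
      HasDerivAt (fun x => log (1 + x) ^ (m + 1) / (m + 1)) (log (1 + x) ^ m / (1 + x)) x := by
    convert! (((hasDerivAt_id' x).const_add 1).log (hx h)).fun_pow (m + 1) |>.div_const
      ((m : ℝ) + 1) using 1
    push_cast
    field_simp
  have hi : IntervalIntegrable (fun x => log (1 + x) ^ m / (1 + x)) volume (j : ℝ) (j + 1) :=
    (((ContinuousOn.log (by fun_prop) fun x h => hx h).pow m).div (by fun_prop)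
      fun x h => hx h).intervalIntegrable
  rw [intervalIntegral.integral_eq_sub_of_hasDerivAt hd hi]
  ring_nf

section

variable {μ : Measure ℝ} {m : ℕ} {a b c : ℝ}

lemma IsPositiveLaw.integral_pow_mul_exp
    (h : IsPositiveLaw μ a b c fun x => (log (1 + x) / x) ^ m / (1 + x)) {x : ℝ} (hx : 0 < x) :
    ∫ s, x ^ m * exp (-(x * s)) ∂μ = log (1 + x) ^ m / (1 + x) := by
  rw [integral_const_mul, h.laplace x hx, div_pow]
  field_simp

lemma IsPositiveLaw.integrable_prod
    (h : IsPositiveLaw μ a b c fun x => (log (1 + x) / x) ^ m / (1 + x)) (j : ℕ) :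
    Integrable (Function.uncurry fun x s : ℝ => x ^ m * exp (-(x * s)))
      ((volume.restrict (Set.uIoc (j : ℝ) (j + 1))).prod μ) := by
  have := h.prob
  rw [Set.uIoc_of_le (by simp)]
  have hae : ∀ᵐ p ∂(volume.restrict (Set.Ioc (j : ℝ) (j + 1))).prod μ,
      p.1 ∈ Set.Ioc (j : ℝ) (j + 1) ∧ 0 < p.2 := by
    filter_upwards [Measure.quasiMeasurePreserving_fst.ae (ae_restrict_mem measurableSet_Ioc),
      Measure.quasiMeasurePreserving_snd.ae h.pos] with p hp hq using ⟨hp, hq⟩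
  refine Integrable.of_bound (by fun_prop) (((j : ℝ) + 1) ^ m) ?_
  filter_upwards [hae] with p hp
  have hp0 : 0 < p.1 := (Nat.cast_nonneg j).trans_lt hp.1.1
  have h1 : exp (-(p.1 * p.2)) ≤ 1 := exp_le_one_iff.2 (by have := mul_pos hp0 hp.2; linarith)
  have h2 : p.1 ^ m ≤ ((j : ℝ) + 1) ^ m := by
    gcongr
    exact hp.1.2
  simp only [Function.uncurry]
  rw [norm_of_nonneg (by positivity)]
  exact (mul_le_of_le_one_right (by positivity) h1).trans h2

lemma IsPositiveLaw.integrable_stepError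
    (h : IsPositiveLaw μ a b c fun x => (log (1 + x) / x) ^ m / (1 + x)) (j : ℕ) :
    Integrable (stepError m j) μ := by
  have := h.prob
  refine ((integrable_exp_neg_mul_of_pos h.pos (by positivity)).const_mul _).sub ?_
  have := (h.integrable_prod j).integral_prod_right
  simp only [Function.uncurry] at this
  refine this.congr (ae_of_all _ fun s => ?_)
  simp only
  rw [intervalIntegral.integral_of_le (by simp), Set.uIoc_of_le (by simp)]

lemma IsPositiveLaw.integral_stepError
    (h : IsPositiveLaw μ a b c fun x => (log (1 + x) / x) ^ m / (1 + x)) (j : ℕ) :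
    ∫ s, stepError m j s ∂μ = log (j + 2) ^ m / (j + 2) -
      (log (j + 2) ^ (m + 1) / (m + 1) - log (j + 1) ^ (m + 1) / (m + 1)) := by
  have := h.prob
  have hi := (integrable_exp_neg_mul_of_pos h.pos
    (by positivity : (0 : ℝ) ≤ j + 1)).const_mul (((j : ℝ) + 1) ^ m)
  have hi' : Integrable (fun s => ∫ x in (j : ℝ)..j + 1, x ^ m * exp (-(x * s))) μ := by
    convert hi.sub (h.integrable_stepError j) using 1
    ext s
    simp [stepError]
  simp only [stepError]
  rw [integral_sub hi hi', h.integral_pow_mul_exp (by positivity),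
    ← intervalIntegral_integral_swap (h.integrable_prod j), ← integral_log_pow_div]
  congr 1
  · ring_nf
  · refine intervalIntegral.integral_congr_ae (ae_of_all _ fun x hx => ?_)
    rw [Set.uIoc_of_le (by simp)] at hx
    exact h.integral_pow_mul_exp ((Nat.cast_nonneg j).trans_lt hx.1)

lemma log_pow_bound (hm : m ≠ 0) {j : ℝ} (hj : 1 ≤ j) :
    (m + 2) * (2 * j) ^ (m - 1) * ((log (1 + j / 2) / (j / 2)) ^ m / (1 + j / 2)) ≤
      (m + 2) * (2 * m) ^ m * 4 ^ (m + 1) * (2 * j) ^ (-(3 / 2) : ℝ) := by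
  have hm' : (0 : ℝ) < m := by positivity
  obtain ⟨y, rfl⟩ : ∃ y, j = y / 2 := ⟨2 * j, by ring⟩
  have hy : 2 ≤ y := by linarith
  have hy0 : 0 < y := by linarith
  rw [show 2 * (y / 2) = y by ring, show y / 2 / 2 = y / 4 by ring]
  have hl0 : 0 ≤ log (1 + y / 4) := log_nonneg (by linarith)
  have hl : log (1 + y / 4) ≤ 2 * m * y ^ (1 / (2 * m) : ℝ) := by
    calc log (1 + y / 4) ≤ log y := log_le_log (by linarith) (by linarith)
      _ ≤ y ^ (1 / (2 * m) : ℝ) / (1 / (2 * m)) := log_le_rpow_div hy0.le (by positivity)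
      _ = _ := by field_simp
  have hpow : (y ^ (1 / (2 * m) : ℝ)) ^ m = y ^ (1 / 2 : ℝ) := by
    rw [← rpow_natCast, ← rpow_mul hy0.le]
    congr 1
    field_simp
  have hym : y ^ m = y ^ (m - 1) * y := by rw [← pow_succ]; congr 1; omega
  have hyr : y ^ (-(3 / 2) : ℝ) = y ^ (1 / 2 : ℝ) / y ^ 2 := by
    rw [← rpow_natCast, ← rpow_sub hy0]
    norm_num
  calc _ ≤ (m + 2) * y ^ (m - 1) * ((2 * m * y ^ (1 / (2 * m) : ℝ) / (y / 4)) ^ m / (y / 4)) := by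
        gcongr
        linarith
    _ = _ := by
      rw [div_pow, mul_pow, hpow, div_pow, hym, hyr]
      field_simp
      ring

lemma IsPositiveLaw.summable_integral_norm_stepError (hm : m ≠ 0)
    (h : IsPositiveLaw μ a b c fun x => (log (1 + x) / x) ^ m / (1 + x)) :
    Summable fun j => ∫ s, ‖stepError m j s‖ ∂μ := by
  have := h.prob
  rw [← summable_nat_add_iff 1]
  have hs : Summable fun j : ℕ => (m + 2) * (2 * m) ^ m * 4 ^ (m + 1) *
      (2 * ((j + 1 : ℕ) : ℝ)) ^ (-(3 / 2) : ℝ) := by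
    refine Summable.mul_left _ ?_
    have h1 : Summable fun j : ℕ => (2 : ℝ) ^ (-(3 / 2) : ℝ) * (j : ℝ) ^ (-(3 / 2) : ℝ) :=
      (Real.summable_nat_rpow.2 (by norm_num)).mul_left _
    refine ((summable_nat_add_iff 1).2 h1).congr fun j => ?_
    rw [mul_rpow (by norm_num) (by positivity)]
  refine hs.of_nonneg_of_le (fun j => integral_nonneg fun s => norm_nonneg _) fun j => ?_
  have hj : (1 : ℝ) ≤ ((j + 1 : ℕ) : ℝ) := by simp
  refine le_trans ?_ (log_pow_bound hm hj)
  rw [← h.laplace _ (by positivity), ← integral_const_mul]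
  refine integral_mono_ae (h.integrable_stepError _).norm
    ((integrable_exp_neg_mul_of_pos h.pos (by positivity)).const_mul _) ?_
  filter_upwards [h.pos] with s hs
  exact abs_stepError_le hm (by omega) hs

lemma IsPositiveLaw.integral_tsum_stepError (hm : m ≠ 0)
    (h : IsPositiveLaw μ a b c fun x => (log (1 + x) / x) ^ m / (1 + x)) {γ : ℝ}
    (hγ : Tendsto (stieltjesSeq m) atTop (nhds γ)) :
    ∫ s, ∑' j, stepError m j s ∂μ = γ := by
  have h1 := (hasSum_integral_of_summable_integral_norm h.integrable_stepError
    (h.summable_integral_norm_stepError hm)).tendsto_sum_nat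
  refine tendsto_nhds_unique h1 (((tendsto_add_atTop_iff_nat 1).2 hγ).congr fun n => ?_)
  induction n with
  | zero => simp [stieltjesSeq, hm]
  | succ n ih =>
    rw [sum_range_succ, ← ih, h.integral_stepError]
    simp only [stieltjesSeq]
    rw [sum_range_succ _ (n + 1)]
    push_cast
    rw [show (n : ℝ) + 1 + 1 = n + 2 by ring]
    ring

lemma integral_lt_integral_of_ae_lt {α : Type*} [MeasurableSpace α] {ν : Measure α}
    [NeZero ν] {f g : α → ℝ} (hf : Integrable f ν) (hg : Integrable g ν)
    (hlt : ∀ᵐ x ∂ν, f x < g x) : ∫ x, f x ∂ν < ∫ x, g x ∂ν := by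
  rw [← sub_pos, ← integral_sub hg hf,
    integral_pos_iff_support_of_nonneg_ae (hlt.mono fun x hx => sub_nonneg.2 hx.le) (hg.sub hf)]
  have : Function.support (fun x => g x - f x) =ᵐ[ν] Set.univ := by
    filter_upwards [hlt] with x hx
    have : g x - f x ≠ 0 := (sub_pos.2 hx).ne'
    exact propext ⟨fun _ => trivial, fun _ => this⟩
  rw [measure_congr this]
  exact Measure.measure_univ_pos.2 (NeZero.ne ν)

end

/-- Bounds on `γ_{2q}` with the sign normalized. -/
lemma stieltjes_bounds_of_tendsto {q : ℕ} (hq : q ≠ 0) {γ : ℝ}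
    (hγ : Tendsto (stieltjesSeq (2 * q)) atTop (nhds γ)) :
    |((bernoulli (2 * q + 2) : ℚ) : ℝ)| / 2 -
        (2 * q + 3) * (2 * q + 4) * |((bernoulli (2 * q + 4) : ℚ) : ℝ)| / 48 < (-1) ^ q * γ ∧
      (-1) ^ q * γ < |((bernoulli (2 * q + 2) : ℚ) : ℝ)| / 2 := by
  obtain ⟨μ, h⟩ := exists_isPositiveLaw_log_pow (2 * q)
  have := h.prob
  have hm : 2 * q ≠ 0 := by omega
  set B := |((bernoulli (2 * q + 2) : ℚ) : ℝ)|
  set B' := |((bernoulli (2 * q + 4) : ℚ) : ℝ)|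
  have hB' : 0 ≤ B' := abs_nonneg _
  have hbd : ∀ᵐ s ∂μ, B / (2 * q + 2) * s - B' / (6 * (2 * q + 4)) * s ^ 3 <
      (-1) ^ q * ∑' j, stepError (2 * q) j s ∧
      (-1) ^ q * ∑' j, stepError (2 * q) j s < B / (2 * q + 2) * s := by
    filter_upwards [h.pos] with s hs
    rw [(hasSum_stepError hm hs).tsum_eq]
    exact tsum_pow_mul_exp_sub_bounds hq hs
  have hmeas : AEStronglyMeasurable (fun s => ∑' j, stepError (2 * q) j s) μ := by
    refine aestronglyMeasurable_of_tendsto_ae atTop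
      (f := fun n s => ∑ j ∈ range n, stepError (2 * q) j s) (fun n => ?_) ?_
    · exact (integrable_finsetSum _ fun j _ => h.integrable_stepError j).aestronglyMeasurable
    · filter_upwards [h.pos] with s hs
      exact (hasSum_stepError hm hs).summable.hasSum.tendsto_sum_nat
  have hhi : Integrable (fun s => B / (2 * q + 2) * s) μ := h.integrable_one.const_mul _
  have hlo : Integrable (fun s => B / (2 * q + 2) * s - B' / (6 * (2 * q + 4)) * s ^ 3) μ :=
    hhi.sub (h.integrable_three.const_mul _)
  have hint : Integrable (fun s => (-1) ^ q * ∑' j, stepError (2 * q) j s) μ :=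
    integrable_of_le_of_le (hmeas.const_mul _) (hbd.mono fun s hs => hs.1.le)
      (hbd.mono fun s hs => hs.2.le) hlo hhi
  have e1 := integral_lt_integral_of_ae_lt hlo hint (hbd.mono fun s hs => hs.1)
  have e2 := integral_lt_integral_of_ae_lt hint hhi (hbd.mono fun s hs => hs.2)
  rw [integral_const_mul, h.integral_tsum_stepError hm hγ] at e1 e2
  rw [integral_sub hhi (h.integrable_three.const_mul _), integral_const_mul, integral_const_mul,
    h.moment_one, h.moment_three] at e1
  rw [integral_const_mul, h.moment_one] at e2
  push_cast at e1 e2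
  have v1 : B / (2 * q + 2) * ((2 * q + 2) / 2) = B / 2 := by field_simp
  have v2 : B' / (6 * (2 * q + 4)) * ((2 * q + 3) * (2 * q + 4) ^ 2 / 8) =
      (2 * q + 3) * (2 * q + 4) * B' / 48 := by
    field_simp
    ring
  rw [v1] at e1 e2
  rw [v2] at e1
  exact ⟨e1, e2⟩


/-- Bernoulli-number bounds for `γ_m` when `m ≡ 2 (mod 4)` and when
`m ≡ 0 (mod 4)`, `m > 0`. -/
theorem stieltjes_bernoulli_bounds_even (m : ℕ) (γm : ℝ)
    (hγ : Tendsto (stieltjesSeq m) atTop (nhds γm)) :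
    (m % 4 = 2 →
      -(|((bernoulli (m + 2) : ℚ) : ℝ)| / 2) < γm ∧
      γm < (m + 3) * (m + 4) * |((bernoulli (m + 4) : ℚ) : ℝ)| / 48 -
            |((bernoulli (m + 2) : ℚ) : ℝ)| / 2) ∧
    (m % 4 = 0 → 0 < m →
      |((bernoulli (m + 2) : ℚ) : ℝ)| / 2 -
          (m + 3) * (m + 4) * |((bernoulli (m + 4) : ℚ) : ℝ)| / 48 < γm ∧
      γm < |((bernoulli (m + 2) : ℚ) : ℝ)| / 2) := by
  constructor
  · intro hm
    obtain ⟨q, rfl⟩ : ∃ q, m = 2 * q := ⟨m / 2, by omega⟩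
    have hodd : Odd q := Nat.odd_iff.2 (by omega)
    obtain ⟨h1, h2⟩ := stieltjes_bounds_of_tendsto (by omega) hγ
    rw [hodd.neg_one_pow] at h1 h2
    push_cast
    constructor <;> linarith
  · intro hm h0
    obtain ⟨q, rfl⟩ : ∃ q, m = 2 * q := ⟨m / 2, by omega⟩
    have heven : Even q := Nat.even_iff.2 (by omega)
    obtain ⟨h1, h2⟩ := stieltjes_bounds_of_tendsto (by omega) hγ
    rw [heven.neg_one_pow, one_mul] at h1 h2
    push_cast
    exact ⟨h1, h2⟩
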